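/- Let q = p^f > 2 be a prime power and let e_p(u) = e^{2πiu/p}. For every subset S ⊆ 𝔽_q, the number n_S of functions f : 𝔽_q → S with ∑_{c ∈ 𝔽_q} c·f(c) = 0 satisfies n_S = |S|^q/q + ((q−1)/q) · ∏_{b ∈ 𝔽_q} ∑_{t ∈ S} e_p(Tr(bt)), where Tr : 𝔽_q → 𝔽_p is the absolute trace. -/

import Mathlib

open Finset

/-- `n_S`: the number of functions `f : 𝔽_q → S` with `∑ c, c * f c = 0`. -/
noncomputable def nS {F : Type*} [Field F] [Fintype F] (S : Finset F) : ℕ :=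
  Nat.card {f : F → F // (∀ c, f c ∈ S) ∧ ∑ c : F, c * f c = 0}

/-- `e_p(u) = exp(2πiu/p)` for `u : ZMod p`. -/
noncomputable def ep (p : ℕ) (u : ZMod p) : ℂ :=
  Complex.exp (2 * Real.pi * Complex.I * (u.val : ℂ) / p)

/-- The absolute trace `Tr : 𝔽_q → 𝔽_p`. -/
noncomputable def absTrace {F : Type*} [Field F] [Fintype F] (p : ℕ) [CharP F p] (x : F) :
    ZMod p :=
  letI := ZMod.algebra F p
  Algebra.trace (ZMod p) F x

/-- The canonical additive character exists and is primitive. -/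
theorem exists_char (F : Type*) [Field F] [Fintype F] (p : ℕ) [Fact p.Prime] [CharP F p] :
    ∃ ψ : AddChar F ℂ, ψ.IsPrimitive ∧ ∀ x, ep p (absTrace p x) = ψ x := by
  letI := ZMod.algebra F p
  haveI : NeZero p := ⟨(Fact.out : p.Prime).ne_zero⟩
  refine ⟨(ZMod.stdAddChar (N := p)).compAddMonoidHom
    (Algebra.trace (ZMod p) F).toAddMonoidHom, ?_, ?_⟩
  · apply AddChar.IsPrimitive.of_ne_one
    intro h
    obtain ⟨a, ha⟩ := Algebra.trace_surjective (ZMod p) F 1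
    have h1 := DFunLike.congr_fun h a
    have h2 : ZMod.stdAddChar (N := p) (Algebra.trace (ZMod p) F a) = 1 := h1
    rw [ha] at h2
    have h3 : (1 : ZMod p) = 0 := ZMod.injective_stdAddChar (by rw [h2, AddChar.map_zero_eq_one])
    exact one_ne_zero h3
  · intro x
    change ep p (Algebra.trace (ZMod p) F x) =
      ZMod.stdAddChar (N := p) (Algebra.trace (ZMod p) F x)
    rw [ZMod.stdAddChar_apply, ZMod.toCircle_apply]
    rfl

theorem nS_eq (F : Type*) [Field F] [Fintype F]
    (p : ℕ) [Fact p.Prime] [CharP F p]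
    (q : ℕ) (hq : q = Fintype.card F) (hq2 : 2 < q)
    (S : Finset F) :
    (nS S : ℂ) = (S.card : ℂ) ^ q / q +
      ((q : ℂ) - 1) / q * ∏ b : F, ∑ t ∈ S, ep p (absTrace p (b * t)) := by
  classical
  obtain ⟨ψ, hψ, hep⟩ := exists_char F p
  simp only [hep]
  have hq0 : (q : ℂ) ≠ 0 := by
    have : q ≠ 0 := by omega
    exact_mod_cast this
  have hn : nS S = ((Fintype.piFinset (fun _ : F => S)).filter
      (fun f => ∑ c : F, c * f c = 0)).card := by
    unfold nS
    rw [Nat.card_eq_fintype_card]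
    apply Fintype.card_of_subtype
    intro f
    simp [Fintype.mem_piFinset]
  have key : (q : ℂ) * nS S = ∑ a : F, ∏ c : F, ∑ t ∈ S, ψ (a * (c * t)) := by
    have h1 : ∀ a : F, ∏ c : F, ∑ t ∈ S, ψ (a * (c * t)) =
        ∑ f ∈ Fintype.piFinset (fun _ : F => S), ψ (a * ∑ c : F, c * f c) := by
      intro a
      rw [Finset.prod_univ_sum]
      refine Finset.sum_congr rfl fun f _ => ?_
      rw [Finset.mul_sum]
      exact (map_prod ψ.toMonoidHom (fun c => Multiplicative.ofAdd (a * (c * f c))) univ).symm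
    simp only [h1]
    rw [Finset.sum_comm]
    simp only [AddChar.sum_mulShift _ hψ]
    rw [hn, hq, Finset.card_filter]
    push_cast
    rw [Finset.mul_sum]
    refine Finset.sum_congr rfl fun f _ => ?_
    split_ifs <;> simp
  have h0 : ∀ a ∈ (univ : Finset F).erase 0, ∏ c : F, ∑ t ∈ S, ψ (a * (c * t)) =
      ∏ b : F, ∑ t ∈ S, ψ (b * t) := by
    intro a ha
    have ha0 : a ≠ 0 := Finset.ne_of_mem_erase ha
    refine Fintype.prod_equiv (Equiv.mulLeft₀ a ha0) _ _ fun c => ?_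
    simp [mul_assoc]
  rw [← Finset.add_sum_erase _ _ (Finset.mem_univ (0 : F)), Finset.sum_congr rfl h0,
    Finset.sum_const, Finset.card_erase_of_mem (Finset.mem_univ _), Finset.card_univ, ← hq,
    nsmul_eq_mul, Nat.cast_sub (by omega)] at key
  simp only [zero_mul, AddChar.map_zero_eq_one, Finset.sum_const, Finset.prod_const,
    Finset.card_univ, ← hq, nsmul_eq_mul, mul_one, Nat.cast_one] at key
  field_simp
  rw [mul_comm]
  exact key
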